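/- Fix ε ∈ (0, 2/3). There exists a constant c > 0 such that for all sufficiently large k, all n with k ≤ n^(2/3 − ε), all d with 0 < d < √k, and all m with m ≤ c·k^1.5/d³, the following holds: let v_1, …, v_m be independent random vectors in ℝ^n with i.i.d. standard Gaussian N(0,1) entries, and for a subset U ⊆ {1,…,n} of size k let F_U denote the event that |Σ_{i∈U} (v_j)_i| > d for every j ∈ {1,…,m}. Then for every S ⊆ {1,…,n} with |S| = k, Σ_{T} P[F_S ∩ F_T] ≤ 1.5 · C(n,k) · P[F_S]², where the sum ranges over all T ⊆ {1,…,n} with |T| = k and |S ∩ T| ≤ d·√k, and C(n,k) denotes the binomial coefficient. -/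

import Mathlib

open MeasureTheory ProbabilityTheory
open scoped NNReal ENNReal

/-- The sign function: `1` if `0 ≤ z`, `-1` otherwise. -/
noncomputable def sgn (z : ℝ) : ℝ := if 0 ≤ z then 1 else -1

/-- `X_k(R)`: vectors in `ℝ^n` with at most `k` nonzero entries whose nonzero
entries have magnitude ratio at most `R`. -/
def sparseDR (n k : ℕ) (R : ℝ) : Set (Fin n → ℝ) :=
  {x | (Finset.univ.filter fun i => x i ≠ 0).card ≤ k ∧
       ∀ i j : Fin n, x i ≠ 0 → x j ≠ 0 → |x i| ≤ R * |x j|}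

/-- `A` is a valid universal 1-bit measurement matrix for support recovery on `X_k(R)`. -/
def ValidMeas (m n k : ℕ) (R : ℝ) (A : Fin m → Fin n → ℝ) : Prop :=
  ∀ u ∈ sparseDR n k R, ∀ v ∈ sparseDR n k R,
    Function.support u ≠ Function.support v →
      (fun i => sgn (∑ j, A i j * u j)) ≠ (fun i => sgn (∑ j, A i j * v j))

/-- `V ⊆ ℝ^n` is `(n, ℓ, d)`-balanced. -/
def IsBalanced (n ℓ : ℕ) (d : ℝ) (V : Set (Fin n → ℝ)) : Prop :=
  ∀ S : Finset (Fin n), S.card = ℓ → ∃ v ∈ V, |∑ i ∈ S, v i| ≤ d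

/-- Law of a random vector in `ℝ^n` with i.i.d. standard Gaussian entries. -/
noncomputable def gaussVec (n : ℕ) : Measure (Fin n → ℝ) :=
  Measure.pi fun _ => gaussianReal 0 1

/-- Law of `m` independent random vectors in `ℝ^n` with i.i.d. standard Gaussian entries
(equivalently, an `m × n` random matrix with i.i.d. `N(0,1)` entries). -/
noncomputable def gaussMat (m n : ℕ) : Measure (Fin m → Fin n → ℝ) :=
  Measure.pi fun _ => gaussVec n

/-- The event `F_U`: every one of the `m` vectors `v j` satisfies `|∑_{i ∈ U} (v j) i| > d`. -/
def FEvent (m n : ℕ) (d : ℝ) (U : Finset (Fin n)) : Set (Fin m → Fin n → ℝ) :=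
  {v | ∀ j : Fin m, d < |∑ i ∈ U, v j i|}

/-- A centred Gaussian puts on an interval at most its peak density times the length. -/
lemma gaussianReal_Icc_le {v : ℝ≥0} (hv : v ≠ 0) (a b : ℝ) :
    gaussianReal 0 v (Set.Icc a b) ≤ ENNReal.ofReal ((√(2 * Real.pi * v))⁻¹ * (b - a)) := by
  rw [gaussianReal_apply _ hv, ENNReal.ofReal_mul (by positivity), ← Real.volume_Icc,
    ← setLIntegral_const]
  refine lintegral_mono fun x => ENNReal.ofReal_le_ofReal ?_
  rw [gaussianPDFReal]
  refine mul_le_of_le_one_right (by positivity) (Real.exp_le_one_iff.2 ?_)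
  exact div_nonpos_of_nonpos_of_nonneg (neg_nonpos.2 (sq_nonneg _)) (by positivity)

lemma le_gaussianReal_Icc {v : ℝ≥0} (hv : v ≠ 0) {d : ℝ} (hd : 0 ≤ d) :
    ENNReal.ofReal ((√(2 * Real.pi * v))⁻¹ * (1 - d ^ 2 / (2 * v)) * (2 * d)) ≤
      gaussianReal 0 v (Set.Icc (-d) d) := by
  rw [gaussianReal_apply _ hv, ENNReal.ofReal_mul' (by positivity), show 2 * d = d - -d by ring,
    ← Real.volume_Icc, ← setLIntegral_const]
  refine setLIntegral_mono' measurableSet_Icc fun x hx => ENNReal.ofReal_le_ofReal ?_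
  rw [gaussianPDFReal]
  refine mul_le_mul_of_nonneg_left ?_ (by positivity)
  have hx2 : x ^ 2 ≤ d ^ 2 := sq_le_sq' hx.1 hx.2
  have h1 := Real.add_one_le_exp (-(x - 0) ^ 2 / (2 * (v : ℝ)))
  have h2 : x ^ 2 / (2 * (v : ℝ)) ≤ d ^ 2 / (2 * v) := by gcongr
  rw [sub_zero, neg_div] at *
  linarith

instance isProbabilityMeasure_gaussVec (n : ℕ) : IsProbabilityMeasure (gaussVec n) := by
  unfold gaussVec; infer_instance

lemma iIndepFun_gaussVec (n : ℕ) :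
    iIndepFun (fun (i : Fin n) (x : Fin n → ℝ) => x i) (gaussVec n) :=
  iIndepFun_pi (X := fun _ => id) fun _ => aemeasurable_id

/-- A sum of `|U|` independent standard Gaussians is a centred Gaussian of variance `|U|`. -/
lemma map_sum_gaussVec {n : ℕ} (U : Finset (Fin n)) :
    (gaussVec n).map (fun x => ∑ i ∈ U, x i) = gaussianReal 0 (U.card : ℝ≥0) := by
  induction U using Finset.induction_on with
  | empty => simp
  | insert a s ha ih =>
    have hind : IndepFun (fun x : Fin n → ℝ => x a) (fun x => ∑ i ∈ s, x i) (gaussVec n) := by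
      have h := (iIndepFun_gaussVec n).indepFun_finsetSum_of_notMem
        (fun i => measurable_pi_apply i) ha
      convert h.symm using 1
      ext x; simp
    have hmap : (gaussVec n).map (fun x => x a) = gaussianReal 0 1 :=
      (measurePreserving_eval (fun _ : Fin n => gaussianReal 0 1) a).map_eq
    have h := gaussianReal_add_gaussianReal_of_indepFun hind hmap ih
    simp only [Finset.sum_insert ha, Finset.card_insert_of_notMem ha]
    rw [add_zero] at h
    rw [Nat.cast_add_one, add_comm (s.card : ℝ≥0)]
    exact h

lemma measurable_sum_coord {n : ℕ} (U : Finset (Fin n)) :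
    Measurable fun x : Fin n → ℝ => ∑ i ∈ U, x i :=
  Finset.measurable_sum _ fun i _ => measurable_pi_apply i

lemma gaussVec_abs_sum_le {n : ℕ} (U : Finset (Fin n)) (d : ℝ) :
    gaussVec n {x | |∑ i ∈ U, x i| ≤ d} =
      gaussianReal 0 (U.card : ℝ≥0) (Set.Icc (-d) d) := by
  rw [← map_sum_gaussVec, Measure.map_apply (measurable_sum_coord U) measurableSet_Icc]
  congr 1
  ext x
  simp [abs_le]

/-- The part of the sum over `T` that is independent of `S` spreads the sum over `T` out, even
conditionally on the sum over `S`. -/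
lemma gaussVec_abs_sum_le_inter {n : ℕ} (S T : Finset (Fin n)) (d : ℝ) (hTS : (T \ S).card ≠ 0) :
    gaussVec n ({x | |∑ i ∈ S, x i| ≤ d} ∩ {x | |∑ i ∈ T, x i| ≤ d}) ≤
      ENNReal.ofReal ((√(2 * Real.pi * (T \ S).card))⁻¹ * (2 * d)) *
        gaussVec n {x | |∑ i ∈ S, x i| ≤ d} := by
  set X : (Fin n → ℝ) → ℝ × ℝ := fun x => (∑ i ∈ S, x i, ∑ i ∈ S ∩ T, x i) with hX
  set Y : (Fin n → ℝ) → ℝ := fun x => ∑ i ∈ T \ S, x i with hY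
  have hXm : Measurable X := (measurable_sum_coord S).prodMk (measurable_sum_coord (S ∩ T))
  have hYm : Measurable Y := measurable_sum_coord _
  have hind : IndepFun X Y (gaussVec n) := by
    have h := (iIndepFun_gaussVec n).indepFun_finset S (T \ S) Finset.disjoint_sdiff
      (fun i => measurable_pi_apply i)
    have h2 := h.comp (φ := fun z : S → ℝ => (∑ i, z i, ∑ i with i.1 ∈ T, z i))
      (ψ := fun z : (T \ S : Finset (Fin n)) → ℝ => ∑ i, z i) (by fun_prop) (by fun_prop)
    convert h2 using 1
    · ext x
      · simp only [hX, Function.comp]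
        exact (Finset.sum_coe_sort S fun i => x i).symm
      · simp only [hX, Function.comp]
        rw [Finset.sum_filter, Finset.sum_coe_sort S fun i => if i ∈ T then x i else 0,
          ← Finset.sum_filter, Finset.filter_mem_eq_inter]
    · ext x
      simp only [hY, Function.comp]
      exact (Finset.sum_coe_sort (T \ S) fun i => x i).symm
  have hprod := hind.map_prod_eq_prod_map_map hXm.aemeasurable hYm.aemeasurable
  set A : Set (ℝ × ℝ) := {z | |z.1| ≤ d} with hA
  have hAm : MeasurableSet A := measurableSet_le (by fun_prop) measurable_const
  set E : Set ((ℝ × ℝ) × ℝ) := {w | |w.1.1| ≤ d ∧ |w.1.2 + w.2| ≤ d} with hE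
  have hEm : MeasurableSet E := by
    have h1 : Measurable fun w : (ℝ × ℝ) × ℝ => |w.1.1| := by fun_prop
    have h2 : Measurable fun w : (ℝ × ℝ) × ℝ => |w.1.2 + w.2| := by fun_prop
    exact (measurableSet_le h1 measurable_const).inter (measurableSet_le h2 measurable_const)
  have hpre : {x : Fin n → ℝ | |∑ i ∈ S, x i| ≤ d} ∩ {x | |∑ i ∈ T, x i| ≤ d} =
      (fun x => (X x, Y x)) ⁻¹' E := by
    ext x
    have : ∑ i ∈ T, x i = ∑ i ∈ S ∩ T, x i + ∑ i ∈ T \ S, x i := by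
      rw [Finset.inter_comm, Finset.sum_inter_add_sum_sdiff]
    simp [hE, hX, hY, this]
  have hpreA : {x : Fin n → ℝ | |∑ i ∈ S, x i| ≤ d} = X ⁻¹' A := rfl
  rw [hpre, hpreA, ← Measure.map_apply (hXm.prodMk hYm) hEm, hprod, Measure.prod_apply hEm,
    ← Measure.map_apply hXm hAm, ← setLIntegral_const, ← lintegral_indicator hAm]
  refine lintegral_mono fun z => ?_
  by_cases hz : z ∈ A
  · rw [Set.indicator_of_mem hz, map_sum_gaussVec]
    refine (measure_mono (t := Set.Icc (-d - z.2) (d - z.2)) fun y hy => ?_).trans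
      ((gaussianReal_Icc_le (by exact_mod_cast hTS) _ _).trans_eq ?_)
    · have := abs_le.1 hy.2
      constructor <;> linarith [this.1, this.2]
    · simp only [NNReal.coe_natCast]
      ring_nf
  · rw [Set.indicator_of_notMem hz]
    refine (measure_mono_null (t := ∅) (fun y hy => hz hy.1) measure_empty).le

/-- Inclusion–exclusion for two events whose complements both have probability `P` and jointly
have probability `B`, with `P` close to `a` and `B` close to `a ^ 2`. -/
lemma one_sub_two_mul_add_le {δ a P B : ℝ} (hδ0 : 0 < δ) (hδ : δ ≤ 1 / 2)
    (ha : a ≤ 0.8 * δ) (hP0 : 0 ≤ P) (hP : P ≤ a) (hPl : a * (1 - δ ^ 2 / 2) ≤ P)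
    (hB : B ≤ a * (1 + 2 * δ) * P) :
    1 - 2 * P + B ≤ (1 - P) ^ 2 * (1 + 32 * δ ^ 3) := by
  have h1 : a * (1 + 2 * δ) - P ≤ 3 * δ ^ 2 := by
    have : a * (2 * δ + δ ^ 2 / 2) ≤ 0.8 * δ * (2 * δ + δ ^ 2 / 2) := by gcongr
    nlinarith [pow_pos hδ0 2]
  have h2 : (a * (1 + 2 * δ) - P) * P ≤ 3 * δ ^ 2 * δ :=
    mul_le_mul h1 (by linarith) hP0 (by positivity)
  have h3 : 1 / 4 ≤ (1 - P) ^ 2 := by nlinarith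
  have h4 : 1 / 4 * (32 * δ ^ 3) ≤ (1 - P) ^ 2 * (32 * δ ^ 3) := by gcongr
  nlinarith [pow_pos hδ0 3]

lemma five_halves_le_sqrt_two_pi : (5 / 2 : ℝ) ≤ √(2 * Real.pi) :=
  Real.le_sqrt_of_sq_le (by nlinarith [Real.pi_gt_d2])

lemma inv_sqrt_two_pi_mul_le {δ k t : ℝ} (hδ0 : 0 < δ) (hδ : δ ≤ 1 / 2) (hk : 0 < k)
    (ht : (1 - δ) * k ≤ t) :
    (√(2 * Real.pi * t))⁻¹ ≤ (1 + 2 * δ) * (√(2 * Real.pi * k))⁻¹ := by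
  have ht0 : 0 < t := lt_of_lt_of_le (by nlinarith) ht
  have hs : √(2 * Real.pi * k) ≤ (1 + 2 * δ) * √(2 * Real.pi * t) := by
    refine Real.sqrt_le_iff.2 ⟨by positivity, ?_⟩
    rw [mul_pow, Real.sq_sqrt (by positivity)]
    have h1 : 1 ≤ (1 + 2 * δ) ^ 2 * (1 - δ) := by nlinarith [mul_pos hδ0 hδ0]
    have h2 : k ≤ (1 + 2 * δ) ^ 2 * t := by
      calc k ≤ (1 + 2 * δ) ^ 2 * (1 - δ) * k := le_mul_of_one_le_left hk.le h1
        _ = (1 + 2 * δ) ^ 2 * ((1 - δ) * k) := by ring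
        _ ≤ _ := by gcongr
    nlinarith [Real.pi_pos]
  rw [← div_eq_mul_inv, inv_le_iff_one_le_mul₀ (by positivity), div_mul_eq_mul_div,
    le_div_iff₀ (by positivity), one_mul]
  exact hs

/-- The correlation between the two one-row events is of order `δ ^ 3`, where `δ = d / √k`. -/
lemma gaussVec_real_inter_le {n k : ℕ} {d : ℝ} (hd : 0 < d) (hdk : d < √k) {S T : Finset (Fin n)}
    (hS : S.card = k) (hT : T.card = k) (hST : ((S ∩ T).card : ℝ) ≤ d * √k) :
    (gaussVec n).real ({x | d < |∑ i ∈ S, x i|} ∩ {x | d < |∑ i ∈ T, x i|}) ≤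
      (gaussVec n).real {x | d < |∑ i ∈ S, x i|} ^ 2 * (1 + 32 * (d / √k) ^ 3) := by
  have hsk : 0 < √(k : ℝ) := hd.trans hdk
  have hk : (0 : ℝ) < k := Real.sqrt_pos.1 hsk
  have hkk : √(k : ℝ) ^ 2 = k := Real.sq_sqrt hk.le
  have hkN : (k : ℝ≥0) ≠ 0 := by exact_mod_cast hk.ne'
  set δ := d / √k with hδdef
  have hd' : d = δ * √k := by rw [hδdef]; field_simp
  have hδ0 : 0 < δ := div_pos hd hsk
  have hδ1 : δ < 1 := (div_lt_one hsk).2 hdk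
  set a := (√(2 * Real.pi * k))⁻¹ * (2 * d) with hadef
  have ha' : a = 2 * δ / √(2 * Real.pi) := by
    rw [hadef, Real.sqrt_mul (by positivity), hd']
    have : 0 < √(2 * Real.pi) := by positivity
    field_simp
  have ha0 : 0 ≤ a := by positivity
  have ha : a ≤ 0.8 * δ := by
    rw [ha', div_le_iff₀ (by positivity)]
    nlinarith [five_halves_le_sqrt_two_pi]
  set CS : Set (Fin n → ℝ) := {x | |∑ i ∈ S, x i| ≤ d} with hCS
  set CT : Set (Fin n → ℝ) := {x | |∑ i ∈ T, x i| ≤ d} with hCT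
  have hCSm : MeasurableSet CS := measurableSet_le (measurable_sum_coord S).abs measurable_const
  have hCTm : MeasurableSet CT := measurableSet_le (measurable_sum_coord T).abs measurable_const
  have hES : {x : Fin n → ℝ | d < |∑ i ∈ S, x i|} = CSᶜ := by ext; simp [hCS]
  have hET : {x : Fin n → ℝ | d < |∑ i ∈ T, x i|} = CTᶜ := by ext; simp [hCT]
  set μ := gaussVec n with hμ
  have hPS : μ CS = gaussianReal 0 (k : ℝ≥0) (Set.Icc (-d) d) := hS ▸ gaussVec_abs_sum_le S d
  have hPT : μ CT = gaussianReal 0 (k : ℝ≥0) (Set.Icc (-d) d) := hT ▸ gaussVec_abs_sum_le T d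
  have hPTS : μ.real CT = μ.real CS := by simp [Measure.real, hPS, hPT]
  have hPle : μ.real CS ≤ a := by
    refine ENNReal.toReal_le_of_le_ofReal ha0 (hPS.trans_le ?_)
    refine (gaussianReal_Icc_le hkN _ _).trans_eq ?_
    rw [hadef, NNReal.coe_natCast]
    ring_nf
  have hPge : a * (1 - δ ^ 2 / 2) ≤ μ.real CS := by
    refine (ENNReal.ofReal_le_iff_le_toReal (measure_ne_top _ _)).1 ?_
    rw [hPS]
    refine (le_of_eq ?_).trans (le_gaussianReal_Icc hkN hd.le)
    rw [hadef, NNReal.coe_natCast, hδdef, div_pow, hkk]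
    ring_nf
  rw [hES, hET, probReal_compl_eq_one_sub hCSm]
  rcases le_or_gt δ (1 / 2) with hδ | hδ
  · have hint : μ.real (CSᶜ ∩ CTᶜ) = 1 - 2 * μ.real CS + μ.real (CS ∩ CT) := by
      rw [← Set.compl_union, probReal_compl_eq_one_sub (hCSm.union hCTm)]
      have := measureReal_union_add_inter (μ := μ) (s := CS) hCTm
      linarith
    rw [hint]
    refine one_sub_two_mul_add_le hδ0 hδ ha measureReal_nonneg hPle hPge ?_
    have hcard : ((T \ S).card : ℝ) + (S ∩ T).card = k := by
      rw [Finset.inter_comm, ← hT]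
      exact_mod_cast Finset.card_sdiff_add_card_inter T S
    have hr : (1 - δ) * k ≤ ((T \ S).card : ℝ) := by
      have : d * √k = δ * k := by rw [hd', mul_assoc, ← sq, hkk]
      linarith
    have hTS0 : (0 : ℝ) < (T \ S).card := lt_of_lt_of_le (by nlinarith) hr
    have hb := gaussVec_abs_sum_le_inter S T d (by exact_mod_cast hTS0.ne')
    have hb2 := ENNReal.toReal_mono (ENNReal.mul_ne_top ENNReal.ofReal_ne_top
      (measure_ne_top _ _)) hb
    rw [ENNReal.toReal_mul, ENNReal.toReal_ofReal
      (mul_nonneg (inv_nonneg.2 (Real.sqrt_nonneg _)) (by linarith))] at hb2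
    refine hb2.trans (mul_le_mul_of_nonneg_right ?_ measureReal_nonneg)
    have hinv := inv_sqrt_two_pi_mul_le hδ0 hδ hk hr
    calc _ ≤ (1 + 2 * δ) * (√(2 * Real.pi * k))⁻¹ * (2 * d) :=
        mul_le_mul_of_nonneg_right hinv (by linarith)
      _ = a * (1 + 2 * δ) := by rw [hadef]; ring
  · have hle : μ.real (CSᶜ ∩ CTᶜ) ≤ 1 - μ.real CS := by
      rw [← probReal_compl_eq_one_sub hCSm]
      exact measureReal_mono Set.inter_subset_left
    have hp : 1 / 5 ≤ 1 - μ.real CS := by linarith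
    have h3 : (1 / 2 : ℝ) ^ 3 ≤ δ ^ 3 := by gcongr
    have h4 : 1 ≤ (1 - μ.real CS) * (1 + 32 * δ ^ 3) := by
      nlinarith
    nlinarith

lemma FEvent_eq_pi (m n : ℕ) (d : ℝ) (U : Finset (Fin n)) :
    FEvent m n d U = Set.univ.pi fun _ => {x | d < |∑ i ∈ U, x i|} := by
  ext v; simp [FEvent]

lemma gaussMat_univ_pi (m n : ℕ) (A : Set (Fin n → ℝ)) :
    gaussMat m n (Set.univ.pi fun _ => A) = gaussVec n A ^ m := by
  simp [gaussMat, Measure.pi_pi]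

lemma one_add_pow_le_three_halves {m : ℕ} {x : ℝ} (hx : 0 ≤ x) (hm : m * x ≤ 1 / 3) :
    (1 + x) ^ m ≤ 3 / 2 := by
  have h1 : (1 + x) ^ m ≤ Real.exp (m * x) := by
    rw [Real.exp_nat_mul, add_comm]
    exact pow_le_pow_left₀ (by positivity) (Real.add_one_le_exp x) m
  have h2 : Real.exp (m * x) ≤ Real.exp (1 / 3) := Real.exp_le_exp.2 hm
  have h3 : Real.exp (1 / 3) ≤ 1 / (1 - 1 / 3) := by
    have := Real.one_sub_le_exp_neg (1 / 3)
    rw [Real.exp_neg] at this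
    rwa [le_div_iff₀ (by norm_num), ← le_div_iff₀' (Real.exp_pos _), one_div (Real.exp _)]
  norm_num at h3
  linarith

lemma gaussMat_FEvent_inter_le {n k m : ℕ} {d : ℝ} (hd : 0 < d) (hdk : d < √k)
    {S T : Finset (Fin n)} (hS : S.card = k) (hT : T.card = k)
    (hST : ((S ∩ T).card : ℝ) ≤ d * √k) (hm : m * (32 * (d / √k) ^ 3) ≤ 1 / 3) :
    gaussMat m n (FEvent m n d S ∩ FEvent m n d T) ≤
      (3 / 2 : ℝ≥0∞) * gaussMat m n (FEvent m n d S) ^ 2 := by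
  rw [FEvent_eq_pi, FEvent_eq_pi, ← Set.pi_inter_distrib, gaussMat_univ_pi, gaussMat_univ_pi]
  have h := gaussVec_real_inter_le hd hdk hS hT hST
  have hx : 0 ≤ 32 * (d / √(k : ℝ)) ^ 3 := by positivity
  have hpow := pow_le_pow_left₀ measureReal_nonneg h m
  rw [mul_pow] at hpow
  have hreal := hpow.trans (mul_le_mul_of_nonneg_left (one_add_pow_le_three_halves hx hm)
    (by positivity))
  have h32 : (3 / 2 : ℝ≥0∞) = ENNReal.ofReal (3 / 2) := by
    rw [ENNReal.ofReal_div_of_pos (by norm_num)]; simp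
  rw [h32, ← ofReal_measureReal, ← ofReal_measureReal, ← ENNReal.ofReal_pow measureReal_nonneg,
    ← ENNReal.ofReal_pow measureReal_nonneg, ← ENNReal.ofReal_pow (by positivity),
    ← ENNReal.ofReal_mul (by norm_num)]
  refine ENNReal.ofReal_le_ofReal (hreal.trans_eq ?_)
  ring

/-- analysis of the sum `A`: for `m ≤ c·k^{1.5}/d³`, the sum of
`P[F_S ∩ F_T]` over all `T` of size `k` with `|S ∩ T| ≤ d√k` is at most
`1.5 · C(n,k) · P[F_S]²`. -/
theorem sum_A_upper_bound (ε : ℝ) (hε1 : 0 < ε) (hε2 : ε < 2/3) :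
    ∃ c : ℝ, 0 < c ∧ ∃ K : ℕ, ∀ k n m : ℕ, K ≤ k →
      (k : ℝ) ≤ (n : ℝ) ^ ((2:ℝ)/3 - ε) →
      ∀ d : ℝ, 0 < d → d < Real.sqrt k →
        (m : ℝ) ≤ c * (k : ℝ) ^ (1.5:ℝ) / d ^ 3 →
        ∀ S : Finset (Fin n), S.card = k →
          ∑ T ∈ ((Finset.univ : Finset (Fin n)).powersetCard k).filter
              (fun T => ((S ∩ T).card : ℝ) ≤ d * Real.sqrt k),
            gaussMat m n (FEvent m n d S ∩ FEvent m n d T) ≤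
          (3/2 : ℝ≥0∞) * (n.choose k : ℝ≥0∞) * (gaussMat m n (FEvent m n d S)) ^ 2 := by
  refine ⟨1 / 100, by norm_num, 0, fun k n m _ _ d hd hdk hm S hS => ?_⟩
  have hsk : 0 < √(k : ℝ) := hd.trans hdk
  have hm' : m * (32 * (d / √(k : ℝ)) ^ 3) ≤ 1 / 3 := by
    have hk : (k : ℝ) ^ (1.5 : ℝ) = √(k : ℝ) ^ 3 := by
      rw [Real.sqrt_eq_rpow, ← Real.rpow_natCast, ← Real.rpow_mul (Nat.cast_nonneg k)]
      norm_num
    rw [hk, le_div_iff₀ (by positivity)] at hm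
    have : m * (32 * (d / √(k : ℝ)) ^ 3) = 32 * (m * d ^ 3) / √(k : ℝ) ^ 3 := by
      rw [div_pow]; ring
    rw [this, div_le_iff₀ (by positivity)]
    have : 0 < √(k : ℝ) ^ 3 := by positivity
    linarith
  set F := ((Finset.univ : Finset (Fin n)).powersetCard k).filter
    (fun T => ((S ∩ T).card : ℝ) ≤ d * √k) with hF
  have hcard : F.card ≤ n.choose k := by
    refine (Finset.card_filter_le _ _).trans_eq ?_
    simp
  calc _ ≤ ∑ T ∈ F, (3 / 2 : ℝ≥0∞) * gaussMat m n (FEvent m n d S) ^ 2 := by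
        refine Finset.sum_le_sum fun T hT => ?_
        rw [hF, Finset.mem_filter, Finset.mem_powersetCard] at hT
        exact gaussMat_FEvent_inter_le hd hdk hS hT.1.2 hT.2 hm'
    _ = (F.card : ℝ≥0∞) * ((3 / 2 : ℝ≥0∞) * gaussMat m n (FEvent m n d S) ^ 2) := by
        rw [Finset.sum_const, nsmul_eq_mul]
    _ ≤ (n.choose k : ℝ≥0∞) * ((3 / 2 : ℝ≥0∞) * gaussMat m n (FEvent m n d S) ^ 2) := by
        gcongr
    _ = _ := by ring
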